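/- Let |ψ⟩ be a Haar-random pure state in C^N, U a unitary of size N with entries u_{ij}, p_i = |⟨i|ψ⟩|², q_j = |⟨j|U|ψ⟩|². Then E[(Σ_i p_i²)(Σ_j q_j²)] = ((N−1)!·4!/(N+3)!) · ( (1/6) Σ_{ij} |u_{ij}|⁴ + (1 + (N−2)/6)·N ). In particular this expectation, as a function of U, is minimized exactly when |u_{ij}|² = 1/N for all i,j, i.e. when U is unbiased with respect to the identity. -/

import Mathlib

open Matrix

open MeasureTheory

lemma cub1 : ∃ l : List (ℝ × ℝ × ℝ), ∀ k : ℕ, k < 4 → ∀ α β u v : ℝ,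
    (l.map fun p => p.1 * (α + (p.2.1 ^ 2 + p.2.2 ^ 2) * β + 2 * (p.2.1 * u + p.2.2 * v)) ^ (k + 1)).sum
      = (k + 1) * α ^ k * β + (k + 1) * k * α ^ (k - 1) * (u ^ 2 + v ^ 2) := by
  refine ⟨[(-125/72, 0, 0), (9/14, 1, 0), (9/14, -1, 0), (9/14, 0, 1), (9/14, 0, -1), (-1/126, 3, 0), (-1/126, -3, 0), (-1/126, 0, 3), (-1/126, 0, -3), (-3/14, 1, 1), (-3/14, -1, 1), (-3/14, 1, -1), (-3/14, -1, -1), (3/224, 2, 2), (3/224, -2, 2), (3/224, 2, -2), (3/224, -2, -2)], ?_⟩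
  intro k hk α β u v
  simp only [List.map_cons, List.map_nil, List.sum_cons, List.sum_nil]
  interval_cases k <;> norm_num <;> ring

lemma cub2 : ∃ l : List (ℝ × ℝ × ℝ), ∀ α β u v : ℝ,
    (l.map fun p => p.1 * (α + (p.2.1 ^ 2 + p.2.2 ^ 2) * β + 2 * (p.2.1 * u + p.2.2 * v)) ^ 4).sum
      = 6 * α ^ 2 * β ^ 2 + 24 * α * β * (u ^ 2 + v ^ 2) + 6 * (u ^ 2 + v ^ 2) ^ 2 := by
  refine ⟨[(175/192, 0, 0), (-49/96, 1, 0), (-49/96, -1, 0), (-49/96, 0, 1), (-49/96, 0, -1), (-5/384, 2, 0), (-5/384, -2, 0), (-5/384, 0, 2), (-5/384, 0, -2), (1/96, 3, 0), (1/96, -3, 0), (1/96, 0, 3), (1/96, 0, -3), (29/96, 1, 1), (29/96, -1, 1), (29/96, 1, -1), (29/96, -1, -1), (-13/768, 2, 2), (-13/768, -2, 2), (-13/768, 2, -2), (-13/768, -2, -2)], ?_⟩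
  intro α β u v
  simp only [List.map_cons, List.map_nil, List.sum_cons, List.sum_nil]
  ring

lemma pol (A B : ℂ) (x y : ℝ) : ‖A + (⟨x, y⟩ : ℂ) * B‖ ^ 2 = ‖A‖ ^ 2 + (x ^ 2 + y ^ 2) * ‖B‖ ^ 2
    + 2 * (x * ((starRingEnd ℂ) A * B).re + y * (-((starRingEnd ℂ) A * B).im)) := by
  simp only [← Complex.normSq_eq_norm_sq, Complex.normSq_apply]
  simp
  ring

lemma polsum {N : ℕ} (a b : Fin N → ℂ) (x y : ℝ) :
    ∑ i, ‖(a + (⟨x, y⟩ : ℂ) • b) i‖ ^ 2 = ∑ i, ‖a i‖ ^ 2 + (x ^ 2 + y ^ 2) * ∑ i, ‖b i‖ ^ 2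
    + 2 * (x * (∑ i, (starRingEnd ℂ) (a i) * b i).re + y * (-(∑ i, (starRingEnd ℂ) (a i) * b i).im)) := by
  simp only [Pi.add_apply, Pi.smul_apply, smul_eq_mul, pol, Finset.sum_add_distrib, Finset.mul_sum,
    Complex.re_sum, Complex.im_sum, mul_add, ← Finset.sum_neg_distrib]

lemma uvsq (h : ℂ) : h.re ^ 2 + (-h.im) ^ 2 = ‖h‖ ^ 2 := by
  rw [← Complex.normSq_eq_norm_sq, Complex.normSq_apply]; ring

lemma int_list {Ω : Type*} [MeasurableSpace Ω] (μ : Measure Ω) (l : List (ℝ × ℝ × ℝ))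
    (f : ℝ × ℝ × ℝ → Ω → ℝ) (hf : ∀ p, Integrable (f p) μ) :
    Integrable (fun ω => (l.map fun p => p.1 * f p ω).sum) μ ∧
    ∫ ω, (l.map fun p => p.1 * f p ω).sum ∂μ = (l.map fun p => p.1 * ∫ ω, f p ω ∂μ).sum := by
  induction l with
  | nil => simp
  | cons p l ih =>
    simp only [List.map_cons, List.sum_cons]
    refine ⟨((hf p).const_mul _).add ih.1, ?_⟩
    rw [integral_add ((hf p).const_mul _) ih.1, integral_const_mul, ih.2]

lemma integ {N : ℕ} (μ : Measure (Fin N → ℂ)) [IsProbabilityMeasure μ]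
    (hsphere : μ {ψ | ∑ i, ‖ψ i‖ ^ 2 = 1} = 1) :
    (∀ᵐ ψ ∂μ, ∑ i, ‖ψ i‖ ^ 2 = 1) ∧ ∀ f : (Fin N → ℂ) → ℝ, Continuous f → Integrable f μ := by
  have hcl : IsClosed {ψ : Fin N → ℂ | ∑ i, ‖ψ i‖ ^ 2 = 1} :=
    isClosed_eq (by fun_prop) continuous_const
  have hae : ∀ᵐ ψ ∂μ, ψ ∈ {ψ : Fin N → ℂ | ∑ i, ‖ψ i‖ ^ 2 = 1} :=
    (mem_ae_iff_prob_eq_one hcl.measurableSet).2 hsphere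
  have hK : IsCompact {ψ : Fin N → ℂ | ∑ i, ‖ψ i‖ ^ 2 = 1} := by
    refine (isCompact_closedBall (0 : Fin N → ℂ) 1).of_isClosed_subset hcl ?_
    intro ψ hψ
    simp only [Set.mem_setOf_eq] at hψ
    rw [mem_closedBall_zero_iff, pi_norm_le_iff_of_nonneg zero_le_one]
    intro i
    have := Finset.single_le_sum (f := fun i => ‖ψ i‖ ^ 2) (fun j _ => by positivity)
      (Finset.mem_univ i)
    simp only [hψ] at this
    nlinarith [norm_nonneg (ψ i)]
  refine ⟨hae, fun f hf => ?_⟩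
  have := hf.continuousOn.integrableOn_compact (μ := μ) hK
  rwa [IntegrableOn, Measure.restrict_eq_self_of_ae_mem hae] at this

lemma ext_unitary {N : ℕ} (i0 : Fin N) (a : Fin N → ℂ) (ha : ∑ i, ‖a i‖ ^ 2 = 1) :
    ∃ V : Matrix (Fin N) (Fin N) ℂ, Vᴴ * V = 1 ∧ V i0 = a := by
  have hn : ‖WithLp.toLp 2 a‖ = 1 := by
    rw [EuclideanSpace.norm_eq]; simp [ha]
  have ho : Orthonormal ℂ (({i0} : Set (Fin N)).domRestrict
      (fun _ => (WithLp.toLp 2 a : EuclideanSpace ℂ (Fin N)))) := by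
    constructor
    · intro i; simpa using hn
    · intro i j hij; exact absurd (Subsingleton.elim i j) hij
  obtain ⟨b, hb⟩ := ho.exists_orthonormalBasis_extension_of_card_eq (by simp)
  refine ⟨Matrix.of fun i j => b i j, ?_, ?_⟩
  · rw [mul_eq_one_comm]
    ext i j
    have := orthonormal_iff_ite.1 b.orthonormal j i
    rw [Matrix.mul_apply, Matrix.one_apply]
    simp only [PiLp.inner_apply, RCLike.inner_apply] at this
    simp only [Matrix.conjTranspose_apply, Matrix.of_apply]
    rw [← show (if j = i then (1:ℂ) else 0) = if i = j then 1 else 0 by simp [eq_comm], ← this]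
    rfl
  · ext j
    simp [Matrix.of_apply, hb i0 rfl]

lemma mom {N : ℕ} (i0 : Fin N)
    (μ : Measure (Fin N → ℂ))
    (hinv : ∀ V : Matrix (Fin N) (Fin N) ℂ, Vᴴ * V = 1 →
      Measure.map (fun ψ => V.mulVec ψ) μ = μ) (k : ℕ) (a : Fin N → ℂ) :
    ∫ ψ, (‖a ⬝ᵥ ψ‖ ^ 2) ^ (k + 1) ∂μ
      = (∫ ψ, (‖ψ i0‖ ^ 2) ^ (k + 1) ∂μ) * (∑ i, ‖a i‖ ^ 2) ^ (k + 1) := by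
  set s := ∑ i, ‖a i‖ ^ 2 with hs
  have hs0 : 0 ≤ s := Finset.sum_nonneg fun i _ => by positivity
  rcases hs0.eq_or_lt with h0 | h0
  · have : a = 0 := by
      ext i
      have := (Finset.sum_eq_zero_iff_of_nonneg (fun i _ => by positivity)).1 (hs ▸ h0.symm) i
        (Finset.mem_univ i)
      simpa using this
    rw [← h0]; simp [this]
  · have hsq : Real.sqrt s ^ 2 = s := Real.sq_sqrt hs0
    have hpos := Real.sqrt_pos.2 h0
    obtain ⟨V, hV, hVa⟩ := ext_unitary i0 (fun i => a i / (Real.sqrt s : ℂ)) (by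
      simp only [norm_div, div_pow, ← Finset.sum_div, ← hs]
      simp [hsq, h0.ne'])
    have key : ∫ ψ, (‖ψ i0‖ ^ 2) ^ (k + 1) ∂μ = ∫ ψ, (‖V.mulVec ψ i0‖ ^ 2) ^ (k + 1) ∂μ := by
      conv_lhs => rw [← hinv V hV]
      rw [integral_map]
      · exact (Continuous.matrix_mulVec continuous_const continuous_id).aemeasurable
      · exact (by fun_prop : Continuous fun ψ : Fin N → ℂ => (‖ψ i0‖ ^ 2) ^ (k + 1)).aestronglyMeasurable
    rw [key, ← integral_mul_const]
    congr 1
    ext ψ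
    have : a ⬝ᵥ ψ = (Real.sqrt s : ℂ) * V.mulVec ψ i0 := by
      have hne : (Real.sqrt s : ℂ) ≠ 0 := by exact_mod_cast hpos.ne'
      simp only [Matrix.mulVec, hVa, dotProduct, Finset.mul_sum]
      refine Finset.sum_congr rfl fun i _ => ?_
      field_simp
    rw [this, norm_mul, ← mul_pow, mul_pow ‖_‖]
    simp [hsq, mul_comm]

lemma dot_pol {N : ℕ} (a b ψ : Fin N → ℂ) (x y : ℝ) :
    ‖(a + (⟨x, y⟩ : ℂ) • b) ⬝ᵥ ψ‖ ^ 2 = ‖a ⬝ᵥ ψ‖ ^ 2 + (x ^ 2 + y ^ 2) * ‖b ⬝ᵥ ψ‖ ^ 2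
    + 2 * (x * ((starRingEnd ℂ) (a ⬝ᵥ ψ) * (b ⬝ᵥ ψ)).re
      + y * (-((starRingEnd ℂ) (a ⬝ᵥ ψ) * (b ⬝ᵥ ψ)).im)) := by
  rw [add_dotProduct, smul_dotProduct, smul_eq_mul, pol]

lemma nrm (A B : ℂ) : ‖(starRingEnd ℂ) A * B‖ ^ 2 = ‖A‖ ^ 2 * ‖B‖ ^ 2 := by
  simp [mul_pow]

lemma cont_dot {N : ℕ} (a : Fin N → ℂ) : Continuous fun ψ : Fin N → ℂ => a ⬝ᵥ ψ := by
  unfold dotProduct; fun_prop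

lemma mix2 {N : ℕ} (i0 : Fin N) (μ : Measure (Fin N → ℂ)) [IsProbabilityMeasure μ]
    (hsphere : μ {ψ | ∑ i, ‖ψ i‖ ^ 2 = 1} = 1)
    (hinv : ∀ V : Matrix (Fin N) (Fin N) ℂ, Vᴴ * V = 1 →
      Measure.map (fun ψ => V.mulVec ψ) μ = μ) (a b : Fin N → ℂ) :
    36 * ∫ ψ, ‖a ⬝ᵥ ψ‖ ^ 4 * ‖b ⬝ᵥ ψ‖ ^ 4 ∂μ = (∫ ψ, (‖ψ i0‖ ^ 2) ^ 4 ∂μ) *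
      (6 * (∑ i, ‖a i‖ ^ 2) ^ 2 * (∑ i, ‖b i‖ ^ 2) ^ 2
       + 24 * (∑ i, ‖a i‖ ^ 2) * (∑ i, ‖b i‖ ^ 2) * ‖∑ i, (starRingEnd ℂ) (a i) * b i‖ ^ 2
       + 6 * (‖∑ i, (starRingEnd ℂ) (a i) * b i‖ ^ 2) ^ 2) := by
  obtain ⟨l, hl⟩ := cub2
  have h := (int_list μ l (fun p ψ => (‖(a + (⟨p.2.1, p.2.2⟩ : ℂ) • b) ⬝ᵥ ψ‖ ^ 2) ^ 4)
    (fun p => (integ μ hsphere).2 _ (((cont_dot _).norm.pow 2).pow 4))).2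
  simp only [mom i0 μ hinv 3] at h
  simp only [dot_pol, polsum, hl, mul_left_comm _ (∫ ψ, (‖ψ i0‖ ^ 2) ^ (3+1) ∂μ), List.sum_map_mul_left] at h
  simp only [uvsq, nrm] at h
  rw [← h, ← integral_const_mul]
  congr 1; ext ψ; ring

lemma mix1 {N : ℕ} (i0 : Fin N) (μ : Measure (Fin N → ℂ)) [IsProbabilityMeasure μ]
    (hsphere : μ {ψ | ∑ i, ‖ψ i‖ ^ 2 = 1} = 1)
    (hinv : ∀ V : Matrix (Fin N) (Fin N) ℂ, Vᴴ * V = 1 →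
      Measure.map (fun ψ => V.mulVec ψ) μ = μ) (a b : Fin N → ℂ) (k : ℕ) (hk : k < 4) :
    (k + 1) ^ 2 * ∫ ψ, (‖a ⬝ᵥ ψ‖ ^ 2) ^ k * ‖b ⬝ᵥ ψ‖ ^ 2 ∂μ = (∫ ψ, (‖ψ i0‖ ^ 2) ^ (k + 1) ∂μ) *
      ((k + 1) * (∑ i, ‖a i‖ ^ 2) ^ k * (∑ i, ‖b i‖ ^ 2)
       + (k + 1) * k * (∑ i, ‖a i‖ ^ 2) ^ (k - 1) * ‖∑ i, (starRingEnd ℂ) (a i) * b i‖ ^ 2) := by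
  obtain ⟨l, hl⟩ := cub1
  have h := (int_list μ l (fun p ψ => (‖(a + (⟨p.2.1, p.2.2⟩ : ℂ) • b) ⬝ᵥ ψ‖ ^ 2) ^ (k + 1))
    (fun p => (integ μ hsphere).2 _ (((cont_dot _).norm.pow 2).pow (k + 1)))).2
  simp only [mom i0 μ hinv k] at h
  simp only [dot_pol, polsum, hl k hk, mul_left_comm _ (∫ ψ, (‖ψ i0‖ ^ 2) ^ (k+1) ∂μ), List.sum_map_mul_left] at h
  simp only [uvsq, nrm] at h
  rw [← h, ← integral_const_mul]
  congr 1; ext ψ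
  rcases k with _ | k
  · simp
  · push_cast; ring

lemma crec {N : ℕ} (i0 : Fin N) (μ : Measure (Fin N → ℂ)) [IsProbabilityMeasure μ]
    (hsphere : μ {ψ | ∑ i, ‖ψ i‖ ^ 2 = 1} = 1)
    (hinv : ∀ V : Matrix (Fin N) (Fin N) ℂ, Vᴴ * V = 1 →
      Measure.map (fun ψ => V.mulVec ψ) μ = μ) (k : ℕ) (hk : k < 4) :
    (k + 1) * ∫ ψ, (‖ψ i0‖ ^ 2) ^ k ∂μ = (∫ ψ, (‖ψ i0‖ ^ 2) ^ (k + 1) ∂μ) * (N + k) := by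
  obtain ⟨hae, hint⟩ := integ μ hsphere
  have h1 : ∫ ψ, (‖ψ i0‖ ^ 2) ^ k ∂μ = ∑ j, ∫ ψ, (‖ψ i0‖ ^ 2) ^ k * ‖ψ j‖ ^ 2 ∂μ := by
    rw [← integral_finset_sum _ (fun j _ => hint _ (by fun_prop))]
    refine integral_congr_ae ?_
    filter_upwards [hae] with ψ hψ
    rw [← Finset.mul_sum, hψ, mul_one]
  have h2 : ∀ j, ((k : ℝ) + 1) ^ 2 * ∫ ψ, (‖ψ i0‖ ^ 2) ^ k * ‖ψ j‖ ^ 2 ∂μ =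
      (∫ ψ, (‖ψ i0‖ ^ 2) ^ (k + 1) ∂μ) * ((k + 1) + (k + 1) * k * if j = i0 then 1 else 0) := by
    intro j
    have hs : ∀ j : Fin N, ∑ i, ‖(Pi.single j (1 : ℂ) : Fin N → ℂ) i‖ ^ 2 = 1 := by
      intro j
      rw [Finset.sum_eq_single j] <;> simp +contextual [Pi.single_apply]
    have := mix1 i0 μ hsphere hinv (Pi.single i0 1) (Pi.single j 1) k hk
    rw [hs, hs] at this
    have hd : ‖∑ i, (starRingEnd ℂ) ((Pi.single i0 (1 : ℂ) : Fin N → ℂ) i) * (Pi.single j (1 : ℂ) : Fin N → ℂ) i‖ ^ 2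
        = if j = i0 then 1 else 0 := by
      rw [Finset.sum_eq_single i0] <;> simp +contextual [Pi.single_apply, eq_comm]
      split_ifs <;> simp
    rw [hd] at this
    simpa using this
  have h3 : ((k : ℝ) + 1) ^ 2 * ∫ ψ, (‖ψ i0‖ ^ 2) ^ k ∂μ =
      (∫ ψ, (‖ψ i0‖ ^ 2) ^ (k + 1) ∂μ) * ((k + 1) * N + (k + 1) * k) := by
    rw [h1, Finset.mul_sum, Finset.sum_congr rfl fun j _ => h2 j, ← Finset.mul_sum,
      Finset.sum_add_distrib, ← Finset.mul_sum]
    simp only [Finset.sum_const, Finset.card_univ, Fintype.card_fin, nsmul_eq_mul,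
      Finset.sum_ite_eq', Finset.mem_univ, if_true]
    ring
  have hk0 : (k : ℝ) + 1 ≠ 0 := by positivity
  apply mul_left_cancel₀ hk0
  linear_combination h3

lemma c4 {N : ℕ} (i0 : Fin N) (μ : Measure (Fin N → ℂ)) [IsProbabilityMeasure μ]
    (hsphere : μ {ψ | ∑ i, ‖ψ i‖ ^ 2 = 1} = 1)
    (hinv : ∀ V : Matrix (Fin N) (Fin N) ℂ, Vᴴ * V = 1 →
      Measure.map (fun ψ => V.mulVec ψ) μ = μ) :
    (∫ ψ, (‖ψ i0‖ ^ 2) ^ 4 ∂μ) = ((N - 1).factorial * 24 : ℝ) / ((N + 3).factorial : ℝ) := by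
  have h0 := crec i0 μ hsphere hinv 0 (by norm_num)
  have h1 := crec i0 μ hsphere hinv 1 (by norm_num)
  have h2 := crec i0 μ hsphere hinv 2 (by norm_num)
  have h3 := crec i0 μ hsphere hinv 3 (by norm_num)
  have hN : 0 < N := i0.pos
  obtain ⟨M, rfl⟩ : ∃ M, N = M + 1 := ⟨N - 1, by omega⟩
  have hf : (((M + 1 + 3).factorial : ℕ) : ℝ) = (M + 4) * (M + 3) * (M + 2) * (M + 1) * M.factorial := by
    simp only [Nat.factorial_succ, show M + 1 + 3 = M + 3 + 1 from rfl]
    push_cast; ring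
  rw [hf, Nat.add_sub_cancel]
  have hM : (M.factorial : ℝ) ≠ 0 := by positivity
  rw [eq_div_iff (by positivity)]
  simp only [pow_zero, integral_const, probReal_univ, smul_eq_mul, zero_add] at h0 h1 h2 h3
  norm_num at h0 h1 h2 h3
  set C4 := ∫ ψ, (‖ψ i0‖ ^ 2) ^ 4 ∂μ
  set C3 := ∫ ψ, (‖ψ i0‖ ^ 2) ^ 3 ∂μ
  set C2 := ∫ ψ, (‖ψ i0‖ ^ 2) ^ 2 ∂μ
  set C1 := ∫ ψ, (‖ψ i0‖ ^ 2) ∂μ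
  linear_combination (-(M.factorial : ℝ)) * ((M + 3) * (M + 2) * (M + 1) * h3 + 4 * (M + 2) * (M + 1) * h2 + 12 * (M + 1) * h1 + 24 * h0)

lemma rowsum {N : ℕ} (U : Matrix (Fin N) (Fin N) ℂ) (hU : Uᴴ * U = 1) (i : Fin N) :
    ∑ j, ‖U i j‖ ^ 2 = 1 := by
  have h' : U * Uᴴ = 1 := mul_eq_one_comm.1 hU
  have h := congrArg (fun M : Matrix (Fin N) (Fin N) ℂ => M i i) h'
  rw [Matrix.mul_apply, Matrix.one_apply_eq] at h
  simp only [Matrix.conjTranspose_apply] at h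
  have h2 : ((∑ j, ‖U i j‖ ^ 2 : ℝ) : ℂ) = 1 := by
    rw [← h]; push_cast
    refine Finset.sum_congr rfl fun j _ => ?_
    exact (Complex.mul_conj' _).symm
  exact_mod_cast h2

lemma mainint (N : ℕ) (hN : 0 < N)
    (μ : Measure (Fin N → ℂ)) [IsProbabilityMeasure μ]
    (hsphere : μ {ψ | ∑ i, ‖ψ i‖ ^ 2 = 1} = 1)
    (hinv : ∀ V : Matrix (Fin N) (Fin N) ℂ, Vᴴ * V = 1 →
      Measure.map (fun ψ => V.mulVec ψ) μ = μ)
    (U : Matrix (Fin N) (Fin N) ℂ) (hU : Uᴴ * U = 1) :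
    (∫ ψ, (∑ i, ‖ψ i‖ ^ 4) * ∑ j, ‖U.mulVec ψ j‖ ^ 4 ∂μ =
        ((N - 1).factorial * 24 : ℝ) / ((N + 3).factorial : ℝ) *
          ((1 / 6) * ∑ i, ∑ j, ‖U i j‖ ^ 4 + (1 + ((N : ℝ) - 2) / 6) * N)) := by
  obtain ⟨hae, hint⟩ := integ μ hsphere
  let i0 : Fin N := ⟨0, hN⟩
  rw [← c4 i0 μ hsphere hinv]
  set C := ∫ ψ, (‖ψ i0‖ ^ 2) ^ 4 ∂μ
  have hc : ∀ j, Continuous fun ψ : Fin N → ℂ => U.mulVec ψ j := fun j => cont_dot (U j)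
  have h1 : ∀ i j, ∫ ψ, ‖U.mulVec ψ i‖ ^ 4 * ‖ψ j‖ ^ 4 ∂μ
      = C / 6 * (1 + 4 * ‖U i j‖ ^ 2 + ‖U i j‖ ^ 4) := by
    intro i j
    have := mix2 i0 μ hsphere hinv (U i) (Pi.single j 1)
    have hs : ∀ j : Fin N, ∑ i, ‖(Pi.single j (1 : ℂ) : Fin N → ℂ) i‖ ^ 2 = 1 := by
      intro j
      rw [Finset.sum_eq_single j] <;> simp +contextual [Pi.single_apply]
    have hd : ‖∑ k, (starRingEnd ℂ) (U i k) * (Pi.single j (1 : ℂ) : Fin N → ℂ) k‖ ^ 2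
        = ‖U i j‖ ^ 2 := by
      rw [Finset.sum_eq_single j] <;> simp +contextual [Pi.single_apply]
    rw [hs, hd, rowsum U hU] at this
    simp only [single_one_dotProduct] at this
    change 36 * ∫ ψ, ‖U.mulVec ψ i‖ ^ 4 * ‖ψ j‖ ^ 4 ∂μ = C * _ at this
    linear_combination this / 36
  have h2 : ∫ ψ, (∑ i, ‖ψ i‖ ^ 4) * ∑ j, ‖U.mulVec ψ j‖ ^ 4 ∂μ
      = ∑ i, ∑ j, ∫ ψ, ‖U.mulVec ψ i‖ ^ 4 * ‖ψ j‖ ^ 4 ∂μ := by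
    have hcc : ∀ i j, Continuous fun ψ : Fin N → ℂ => ‖U.mulVec ψ i‖ ^ 4 * ‖ψ j‖ ^ 4 :=
      fun i j => ((hc i).norm.pow 4).mul (by fun_prop)
    simp_rw [← fun i => integral_finset_sum (μ := μ) Finset.univ (fun j _ => hint _ (hcc i j))]
    rw [← integral_finset_sum _ (fun i _ => hint _ (continuous_finset_sum _ fun j _ => hcc i j))]
    congr 1; ext ψ
    rw [mul_comm, Finset.sum_mul_sum]
  rw [h2]
  simp only [h1, ← Finset.mul_sum, Finset.sum_add_distrib, rowsum U hU]
  simp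
  ring

lemma Ssq {N : ℕ} (hN : 0 < N) (U : Matrix (Fin N) (Fin N) ℂ) (hU : Uᴴ * U = 1) :
    ∑ i, ∑ j, ‖U i j‖ ^ 4 = 1 + ∑ i, ∑ j, (‖U i j‖ ^ 2 - 1 / N) ^ 2 := by
  have h : ∀ i j, (‖U i j‖ ^ 2 - 1 / N : ℝ) ^ 2 = ‖U i j‖ ^ 4 - 2 / N * ‖U i j‖ ^ 2 + 1 / N ^ 2 := by
    intro i j; ring
  have hN' : (N : ℝ) ≠ 0 := by positivity
  simp only [h, Finset.sum_add_distrib, Finset.sum_sub_distrib, ← Finset.mul_sum, rowsum U hU]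
  simp
  field_simp
  ring

lemma dft_exists {N : ℕ} (hN : 0 < N) : ∃ V : Matrix (Fin N) (Fin N) ℂ, Vᴴ * V = 1 ∧
    ∀ i j, ‖V i j‖ ^ 2 = 1 / N := by
  obtain ⟨ζ, hζ⟩ : ∃ ζ : ℂ, IsPrimitiveRoot ζ N := ⟨_, Complex.isPrimitiveRoot_exp N hN.ne'⟩
  have hn : ‖ζ‖ = 1 := hζ.norm'_eq_one hN.ne'
  have hz : ζ ≠ 0 := by intro h; simp [h] at hn
  have hconj : (starRingEnd ℂ) ζ = ζ⁻¹ := (Complex.inv_eq_conj hn).symm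
  have hsq : (Real.sqrt N : ℂ) ^ 2 = N := by
    exact_mod_cast congrArg (fun x : ℝ => (x : ℂ)) (Real.sq_sqrt (Nat.cast_nonneg N))
  have hNC : (N : ℂ) ≠ 0 := by exact_mod_cast hN.ne'
  refine ⟨Matrix.of fun i j => ζ ^ ((i : ℕ) * j) / (Real.sqrt N : ℂ), ?_, ?_⟩
  · ext j k
    rw [Matrix.mul_apply, Matrix.one_apply]
    have h1 : ∀ i : Fin N, (Matrix.of fun i j : Fin N => ζ ^ ((i : ℕ) * j) / (Real.sqrt N : ℂ))ᴴ j i *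
        (Matrix.of fun i j : Fin N => ζ ^ ((i : ℕ) * j) / (Real.sqrt N : ℂ)) i k = (ζ ^ (k : ℕ) / ζ ^ (j : ℕ)) ^ (i : ℕ) / N := by
      intro i
      rw [Matrix.conjTranspose_apply]
      simp only [Matrix.of_apply, ← starRingEnd_apply, map_div₀, map_pow, hconj, Complex.conj_ofReal]
      rw [div_mul_div_comm, ← pow_two, hsq]
      congr 1
      rw [div_pow, ← pow_mul, ← pow_mul, inv_pow, mul_comm (k : ℕ), mul_comm (j : ℕ)]
      field_simp
    rw [Finset.sum_congr rfl fun i _ => h1 i, ← Finset.sum_div,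
      Fin.sum_univ_eq_sum_range (fun i => (ζ ^ (k : ℕ) / ζ ^ (j : ℕ)) ^ i) N]
    split_ifs with hjk
    · subst hjk
      simp [hz, hNC]
    · have hw : ζ ^ (k : ℕ) / ζ ^ (j : ℕ) ≠ 1 := by
        intro h
        rw [div_eq_one_iff_eq (pow_ne_zero _ hz)] at h
        exact hjk (Fin.ext (hζ.pow_inj k.2 j.2 h).symm)
      rw [geom_sum_eq hw, div_pow, ← pow_mul, ← pow_mul, mul_comm (k : ℕ), mul_comm (j : ℕ),
        pow_mul, pow_mul, hζ.pow_eq_one]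
      simp
  · intro i j
    simp [hn, div_pow]

/-- For a Haar-random pure state (any unitarily invariant
probability measure concentrated on the unit sphere) and a unitary `U`,
`E[(Σ_i p_i²)(Σ_j q_j²)] = ((N−1)!·4!/(N+3)!)·((1/6) Σ_{ij}|u_{ij}|⁴
+ (1+(N−2)/6)·N)`, and this expectation is minimized among unitaries exactly
when `|u_{ij}|² = 1/N` for all `i, j`. -/
theorem stmt15 (N : ℕ) (hN : 0 < N)
    (μ : Measure (Fin N → ℂ)) [IsProbabilityMeasure μ]
    (hsphere : μ {ψ | ∑ i, ‖ψ i‖ ^ 2 = 1} = 1)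
    (hinv : ∀ V : Matrix (Fin N) (Fin N) ℂ, Vᴴ * V = 1 →
      Measure.map (fun ψ => V.mulVec ψ) μ = μ)
    (U : Matrix (Fin N) (Fin N) ℂ) (hU : Uᴴ * U = 1) :
    (∫ ψ, (∑ i, ‖ψ i‖ ^ 4) * ∑ j, ‖U.mulVec ψ j‖ ^ 4 ∂μ =
        ((N - 1).factorial * 24 : ℝ) / ((N + 3).factorial : ℝ) *
          ((1 / 6) * ∑ i, ∑ j, ‖U i j‖ ^ 4 + (1 + ((N : ℝ) - 2) / 6) * N)) ∧
      ((∀ V : Matrix (Fin N) (Fin N) ℂ, Vᴴ * V = 1 →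
          ∫ ψ, (∑ i, ‖ψ i‖ ^ 4) * ∑ j, ‖U.mulVec ψ j‖ ^ 4 ∂μ ≤
            ∫ ψ, (∑ i, ‖ψ i‖ ^ 4) * ∑ j, ‖V.mulVec ψ j‖ ^ 4 ∂μ) ↔
        ∀ i j, ‖U i j‖ ^ 2 = 1 / N) := by
  have hm := mainint N hN μ hsphere hinv
  refine ⟨hm U hU, ?_⟩
  have hc : 0 < ((N - 1).factorial * 24 : ℝ) / ((N + 3).factorial : ℝ) := by positivity
  rw [hm U hU]
  constructor
  · intro h
    obtain ⟨V, hV, hVN⟩ := dft_exists hN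
    have h1 := le_of_mul_le_mul_left ((h V hV).trans_eq (hm V hV)) hc
    have hVs := Ssq hN V hV
    simp only [hVN, sub_self] at hVs
    have hUs := Ssq hN U hU
    have h0 : ∑ i, ∑ j, (‖U i j‖ ^ 2 - 1 / N : ℝ) ^ 2 = 0 := by
      apply le_antisymm
      · simp at hVs
        simp at hUs h1 ⊢
        linarith
      · positivity
    intro i j
    rw [Finset.sum_eq_zero_iff_of_nonneg (fun i _ => by positivity)] at h0
    have h2 := h0 i (Finset.mem_univ i)
    rw [Finset.sum_eq_zero_iff_of_nonneg (fun i _ => by positivity)] at h2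
    have h3 := h2 j (Finset.mem_univ j)
    exact sub_eq_zero.1 (pow_eq_zero_iff two_ne_zero |>.1 h3)
  · intro h V hV
    rw [hm V hV]
    apply mul_le_mul_of_nonneg_left _ hc.le
    have hVs := Ssq hN V hV
    have hUs := Ssq hN U hU
    have h0 : 0 ≤ ∑ i, ∑ j, (‖V i j‖ ^ 2 - 1 / N : ℝ) ^ 2 := by positivity
    have h1 : ∑ i, ∑ j, (‖U i j‖ ^ 2 - 1 / N : ℝ) ^ 2 = 0 := by simp [h]
    rw [hVs, hUs, h1]
    linarith
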